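/- arXiv:1602.02717 — 4 statements merged into one kernel-verified Lean document; each statement's English description precedes it below -/
import Mathlib

section
/- (The Tulczyjew isomorphism β_Q is an anti-symplectomorphism, coordinate version.) Let n ≥ 1 and let B : (ℝⁿ)⁴ → (ℝⁿ)⁴ be the linear map B(q, p, q̇, ṗ) = (q, p, −ṗ, q̇), i.e. the map sending a tangent vector X = (q̇, ṗ) at (q,p) ∈ ℝⁿ × ℝⁿ to the covector i_X Ω at (q,p), where Ω((a,b),(a',b')) = ⟨a,b'⟩ − ⟨a',b⟩ is the standard symplectic form on ℝⁿ × ℝⁿ. Then B is a linear isomorphism and for all w, w' ∈ (ℝⁿ)⁴ one has ω₂(B w, B w') = −Ωᶜ(w, w'), where Ωᶜ is the complete lift of the canonical symplectic form and ω₂ is the canonical symplectic form on T*(T*ℝⁿ) in coordinates (q, p; c, d). -/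
open scoped RealInnerProductSpace

/-- The Tulczyjew isomorphism `β_Q : T(T*ℝⁿ) → T*(T*ℝⁿ)`, in coordinates
`B(q, p, q̇, ṗ) = (q, p, −ṗ, q̇)` (i.e. `X = (q̇,ṗ) ↦ i_X Ω`), is a linear
isomorphism and an anti-symplectomorphism from the complete lift `Ωᶜ` of the
canonical symplectic form of `T*ℝⁿ` to the canonical symplectic form `ω₂`
of `T*(T*ℝⁿ)`. -/
theorem tulczyjew_beta_antisymplectomorphism (n : ℕ) (hn : 1 ≤ n)
    (B : (EuclideanSpace ℝ (Fin n) × EuclideanSpace ℝ (Fin n) × EuclideanSpace ℝ (Fin n) ×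
        EuclideanSpace ℝ (Fin n)) →
      (EuclideanSpace ℝ (Fin n) × EuclideanSpace ℝ (Fin n) × EuclideanSpace ℝ (Fin n) ×
        EuclideanSpace ℝ (Fin n)))
    (hB : ∀ q p qd pd, B (q, p, qd, pd) = (q, p, -pd, qd))
    (Ωc ω₂ : (EuclideanSpace ℝ (Fin n) × EuclideanSpace ℝ (Fin n) × EuclideanSpace ℝ (Fin n) ×
        EuclideanSpace ℝ (Fin n)) →
      (EuclideanSpace ℝ (Fin n) × EuclideanSpace ℝ (Fin n) × EuclideanSpace ℝ (Fin n) ×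
        EuclideanSpace ℝ (Fin n)) → ℝ)
    (hΩc : ∀ w w', Ωc w w' =
      ⟪w.1, w'.2.2.2⟫ - ⟪w'.1, w.2.2.2⟫ + ⟪w.2.2.1, w'.2.1⟫ - ⟪w'.2.2.1, w.2.1⟫)
    (hω₂ : ∀ w w', ω₂ w w' =
      ⟪w.1, w'.2.2.1⟫ - ⟪w'.1, w.2.2.1⟫ + ⟪w.2.1, w'.2.2.2⟫ - ⟪w'.2.1, w.2.2.2⟫) :
    IsLinearMap ℝ B ∧ Function.Bijective B ∧ ∀ w w', ω₂ (B w) (B w') = -Ωc w w' := by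
  refine ⟨⟨?_, ?_⟩, ⟨?_, ?_⟩, ?_⟩
  · rintro ⟨q, p, qd, pd⟩ ⟨q', p', qd', pd'⟩
    simp only [hB, Prod.mk_add_mk, neg_add]
  · rintro c ⟨q, p, qd, pd⟩
    simp only [hB, Prod.smul_mk, smul_neg]
  · rintro ⟨q, p, qd, pd⟩ ⟨q', p', qd', pd'⟩ h
    simp only [hB, Prod.mk.injEq, neg_inj] at h ⊢
    tauto
  · rintro ⟨q, p, c, d⟩
    exact ⟨(q, p, d, -c), by simp only [hB, neg_neg]⟩
  · rintro ⟨q, p, qd, pd⟩ ⟨q', p', qd', pd'⟩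
    simp only [hB, hω₂, hΩc, inner_neg_right]
    rw [real_inner_comm qd' p, real_inner_comm qd p']
    ring
end

section
/- (The Lagrangian-submanifold equations imply the higher-order Euler–Lagrange equations.) Let n ≥ 1, k ≥ 2, let a₀, a₁, …, a_k : ℝ → ℝⁿ be smooth (C^∞) functions, and let p₀, p₁, …, p_{k−2} : ℝ → ℝⁿ be smooth functions satisfying, for all t ∈ ℝ: (1) p₀'(t) = a₀(t); (2) p_j'(t) + p_{j−1}(t) = a_j(t) for every 1 ≤ j ≤ k−2; (3) a_{k−1}(t) − p_{k−2}(t) = a_k'(t). Then for all t ∈ ℝ the kth-order Euler–Lagrange expression vanishes: Σ_{j=0}^{k} (−1)ʲ (dʲ/dtʲ a_j)(t) = 0. -/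
/-- The alternating sum of derivatives telescopes along the momentum recursion
`a₀ = p₀'`, `a_{j+1} = p_{j+1}' + p_j`. -/
theorem sum_neg_one_pow_smul_iteratedDeriv_of_momentum_recursion
    {E : Type*} [NormedAddCommGroup E] [NormedSpace ℝ E] {a p : ℕ → ℝ → E} {m : ℕ}
    (hp : ∀ j ≤ m, ContDiff ℝ (⊤ : ℕ∞) (p j)) (h0 : a 0 = deriv (p 0))
    (hsucc : ∀ j < m, a (j + 1) = deriv (p (j + 1)) + p j) (t : ℝ) :
    ∑ j ∈ Finset.range (m + 1), (-1 : ℝ) ^ j • iteratedDeriv j (a j) t =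
      (-1 : ℝ) ^ m • iteratedDeriv (m + 1) (p m) t := by
  induction m with
  | zero => simp [h0]
  | succ m ih =>
    have hd : ContDiff ℝ (⊤ : ℕ∞) (deriv (p (m + 1))) :=
      (contDiff_infty_iff_deriv.1 (hp (m + 1) le_rfl)).2
    have hle : ((m + 1 : ℕ) : WithTop ℕ∞) ≤ ((⊤ : ℕ∞) : WithTop ℕ∞) := by
      exact_mod_cast le_top
    rw [Finset.sum_range_succ, ih (fun j hj => hp j (by omega)) (fun j hj => hsucc j (by omega)),
      hsucc m (by omega),
      iteratedDeriv_add (hd.of_le hle).contDiffAt ((hp m (by omega)).of_le hle).contDiffAt,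
      iteratedDeriv_succ' (n := m + 1), pow_succ]
    module


/-- The equations defining the Lagrangian submanifold `N_L = α⁻¹(Σ_L)` imply the
`k`th-order Euler–Lagrange equations: if smooth curves `a₀, …, a_k` (the partial
derivatives of the Lagrangian along a prolongated curve) and momenta
`p₀, …, p_{k−2}` satisfy `p₀' = a₀`, `p_j' + p_{j−1} = a_j` (`1 ≤ j ≤ k−2`) and
`a_{k−1} − p_{k−2} = a_k'`, then `Σ_{j=0}^{k} (−1)ʲ (dʲ/dtʲ a_j) = 0`. -/
theorem lagrangian_submanifold_eqns_imply_euler_lagrange (n k : ℕ)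
    (hn : 1 ≤ n) (hk : 2 ≤ k)
    (a : ℕ → ℝ → EuclideanSpace ℝ (Fin n))
    (ha : ∀ j ≤ k, ContDiff ℝ (⊤ : ℕ∞) (a j))
    (p : ℕ → ℝ → EuclideanSpace ℝ (Fin n))
    (hp : ∀ j ≤ k - 2, ContDiff ℝ (⊤ : ℕ∞) (p j))
    (h1 : ∀ t, deriv (p 0) t = a 0 t)
    (h2 : ∀ j, 1 ≤ j → j ≤ k - 2 → ∀ t, deriv (p j) t + p (j - 1) t = a j t)
    (h3 : ∀ t, a (k - 1) t - p (k - 2) t = deriv (a k) t) :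
    ∀ t, ∑ j ∈ Finset.range (k + 1), ((-1 : ℝ)) ^ j • iteratedDeriv j (a j) t = 0 := by
  intro t
  obtain ⟨m, rfl⟩ := Nat.exists_eq_add_of_le' hk
  simp only [Nat.add_sub_cancel, show m + 2 - 1 = m + 1 by omega] at hp h2 h3
  have hsum := sum_neg_one_pow_smul_iteratedDeriv_of_momentum_recursion (a := a)
    (p := Function.update p (m + 1) (a (m + 2))) (m := m + 1) ?_ ?_ ?_ t
  · rw [Finset.sum_range_succ, hsum, Function.update_self, pow_succ _ (m + 1)]
    module
  · intro j hj
    rcases hj.eq_or_lt with rfl | hj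
    · simpa using ha (m + 2) le_rfl
    · simpa [Function.update_of_ne hj.ne] using hp j (by omega)
  · funext s
    simp [h1]
  · intro j hj
    funext s
    rw [Pi.add_apply, Function.update_of_ne hj.ne]
    rcases (Nat.lt_succ_iff.1 hj).eq_or_lt with rfl | hj
    · rw [Function.update_self, ← h3, sub_add_cancel]
    · rw [Function.update_of_ne (by omega)]
      exact (h2 (j + 1) (by omega) (by omega) s).symm
end

section
/- (Projectability of the pre-Lagrangian function of a kth-order Hamiltonian.) Let n ≥ 1, k ≥ 2, and let H : (ℝⁿ)^k × (ℝⁿ)^k → ℝ be C² and a kth-order Hamiltonian function, i.e. ∇_{p_j} H(q,p) = q_{j+1} for all 0 ≤ j ≤ k−2 and all (q,p). Define G : (ℝⁿ)^k × (ℝⁿ)^k → ℝ by G(q,p) = Σ_{l=0}^{k−2} ⟨p_l, q_{l+1}⟩ + ⟨p_{k−1}, ∇_{p_{k−1}} H(q,p)⟩ − H(q,p). Then for every (q,p), every 0 ≤ s ≤ k−2, and every v ∈ ℝⁿ, the derivative of G in the direction (0, e_s v) vanishes; consequently G(q,p) = G(q,p') whenever p and p' have the same (k−1)st block, i.e. G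 depends only on (q, p_{k−1}). -/
open scoped RealInnerProductSpace

section MomentumBlocks

variable {V : Type*} [NormedAddCommGroup V] [InnerProductSpace ℝ V] [CompleteSpace V]

/-- The derivative in a single block is given by the partial gradient. -/
theorem fderiv_single_eq_inner_partial_gradient {ι : Type*} [Fintype ι] [DecidableEq ι]
    {f : (ι → V) → ℝ} (hf : Differentiable ℝ f) (p : ι → V) (j : ι) (v : V) :
    fderiv ℝ f p (Pi.single j v) = ⟪gradient (fun x => f (Function.update p j x)) (p j), v⟫ := by
  have hfp : DifferentiableAt ℝ f (Function.update p j (p j)) := hf _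
  have hcomp := hfp.hasFDerivAt.comp (p j) (hasFDerivAt_update p (p j))
  have hgrad := hcomp.differentiableAt.hasGradientAt.hasFDerivAt
  have h := congrArg (fun L : V →L[ℝ] ℝ => L v) (hcomp.unique hgrad)
  rw [Function.update_eq_self] at h
  have hpi : (ContinuousLinearMap.pi (Pi.single j (ContinuousLinearMap.id ℝ V))) v =
      (Pi.single j v : ι → V) := by
    ext i
    by_cases hij : i = j
    · subst hij; simp
    · simp [hij]
  simpa [hpi, Function.comp_def] using h

/-- A differentiable function whose partial gradients in all blocks but the last are constant is
affine in these blocks. -/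
theorem sub_eq_sum_inner_of_partial_gradient_eq {m : ℕ} {f : (Fin (m + 1) → V) → ℝ}
    (hf : Differentiable ℝ f) (c : Fin m → V)
    (hgrad : ∀ (p : Fin (m + 1) → V) (j : Fin m),
      gradient (fun x => f (Function.update p j.castSucc x)) (p j.castSucc) = c j)
    {p p' : Fin (m + 1) → V} (hlast : p (Fin.last m) = p' (Fin.last m)) :
    f p - f p' = ∑ j : Fin m, ⟪p j.castSucc, c j⟫ - ∑ j : Fin m, ⟪p' j.castSucc, c j⟫ := by
  set d := p - p' with hd
  set S := ∑ j : Fin m, ⟪d j.castSucc, c j⟫ with hS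
  have hderiv (x : Fin (m + 1) → V) : fderiv ℝ f x d = S := by
    have hsum : d = ∑ i, Pi.single i (d i) := (Finset.univ_sum_single d).symm
    have hdlast : d (Fin.last m) = 0 := by simp [hd, hlast]
    conv_lhs => rw [hsum]
    rw [map_sum, Fin.sum_univ_castSucc, hdlast, Pi.single_zero, map_zero, add_zero]
    refine Finset.sum_congr rfl fun j _ => ?_
    rw [fderiv_single_eq_inner_partial_gradient hf, hgrad, real_inner_comm]
  have hline (t : ℝ) : HasDerivAt (fun t : ℝ => f (p' + t • d) - t * S) 0 t := by
    have hd' : HasDerivAt (fun t : ℝ => p' + t • d) d t := by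
      simpa using ((hasDerivAt_id t).smul_const d).const_add p'
    have h := ((hf (p' + t • d)).hasFDerivAt.comp_hasDerivAt t hd').sub
      ((hasDerivAt_id t).mul_const S)
    rw [hderiv, one_mul, sub_self] at h
    exact h
  have hconst := is_const_of_deriv_eq_zero (fun t => (hline t).differentiableAt)
    (fun t => (hline t).deriv) 1 0
  have hp : p' + d = p := by simp [hd]
  simp only [one_smul, zero_smul, add_zero, one_mul, zero_mul, sub_zero, hp] at hconst
  rw [← Finset.sum_sub_distrib]
  simp only [← inner_sub_left]
  have : S = ∑ j : Fin m, ⟪p j.castSucc - p' j.castSucc, c j⟫ := rfl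
  linarith

end MomentumBlocks

/-- The derivative of a function vanishes in every direction along which it is constant. -/
theorem fderiv_apply_eq_zero_of_forall_add_smul_eq {E : Type*} [NormedAddCommGroup E]
    [NormedSpace ℝ E] {g : E → ℝ} {x v : E} (h : ∀ t : ℝ, g (x + t • v) = g x) :
    fderiv ℝ g x v = 0 := by
  by_cases hg : DifferentiableAt ℝ g x
  · rw [← hg.lineDeriv_eq_fderiv, lineDeriv]
    simp [h]
  · simp [fderiv_zero_of_not_differentiableAt hg]

/-- Projectability of the pre-Lagrangian function of a `k`th-order Hamiltonian:
for a `C²` `k`th-order Hamiltonian function `H` (i.e. `∇_{p_j} H(q,p) = q_{j+1}`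
for `0 ≤ j ≤ k−2`), the function
`G(q,p) = Σ_{l=0}^{k−2} ⟪p_l, q_{l+1}⟫ + ⟪p_{k−1}, ∇_{p_{k−1}} H(q,p)⟫ − H(q,p)`
has vanishing derivative in every momentum direction `(0, e_s v)` with `s ≤ k−2`;
consequently `G` depends only on `(q, p_{k−1})`. -/
theorem pre_lagrangian_projectable (n k : ℕ) (hn : 1 ≤ n) (hk : 2 ≤ k)
    (H : (Fin k → EuclideanSpace ℝ (Fin n)) × (Fin k → EuclideanSpace ℝ (Fin n)) → ℝ)
    (hH : ContDiff ℝ 2 H)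
    (hord : ∀ (q p : Fin k → EuclideanSpace ℝ (Fin n)) (j : ℕ) (hj : j ≤ k - 2),
      gradient (fun x => H (q, Function.update p ⟨j, by omega⟩ x)) (p ⟨j, by omega⟩) =
        q ⟨j + 1, by omega⟩)
    (G : (Fin k → EuclideanSpace ℝ (Fin n)) × (Fin k → EuclideanSpace ℝ (Fin n)) → ℝ)
    (hG : ∀ q p, G (q, p) =
      (∑ l : Fin (k - 1), ⟪p ⟨l.1, by have := l.isLt; omega⟩,
        q ⟨l.1 + 1, by have := l.isLt; omega⟩⟫) +
      ⟪p ⟨k - 1, by omega⟩,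
        gradient (fun x => H (q, Function.update p ⟨k - 1, by omega⟩ x))
          (p ⟨k - 1, by omega⟩)⟫ -
      H (q, p)) :
    (∀ (q p : Fin k → EuclideanSpace ℝ (Fin n)) (s : ℕ) (hs : s ≤ k - 2)
      (v : EuclideanSpace ℝ (Fin n)),
      fderiv ℝ G (q, p) (0, Pi.single ⟨s, by omega⟩ v) = 0) ∧
    (∀ (q p p' : Fin k → EuclideanSpace ℝ (Fin n)),
      p ⟨k - 1, by omega⟩ = p' ⟨k - 1, by omega⟩ → G (q, p) = G (q, p')) := by
  obtain ⟨m, rfl⟩ : ∃ m, k = m + 1 := ⟨k - 1, by omega⟩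
  have hdiff (q : Fin (m + 1) → EuclideanSpace ℝ (Fin n)) :
      Differentiable ℝ fun p => H (q, p) :=
    (hH.differentiable (by norm_num)).comp (by fun_prop)
  have haffine (q : Fin (m + 1) → EuclideanSpace ℝ (Fin n))
      {p p' : Fin (m + 1) → EuclideanSpace ℝ (Fin n)} (h : p (Fin.last m) = p' (Fin.last m)) :=
    sub_eq_sum_inner_of_partial_gradient_eq (hdiff q) (fun j => q j.succ)
      (fun p j => hord q p j.1 (by omega)) h
  have hproj (q p p' : Fin (m + 1) → EuclideanSpace ℝ (Fin n))
      (h : p (Fin.last m) = p' (Fin.last m)) : G (q, p) = G (q, p') := by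
    have hfun : (fun x => H (q, Function.update p (Fin.last m) x)) =
        fun x => H (q, Function.update p' (Fin.last m) x) +
          (∑ j : Fin m, ⟪p j.castSucc, q j.succ⟫ - ∑ j : Fin m, ⟪p' j.castSucc, q j.succ⟫) := by
      funext x
      have hx := haffine q (p := Function.update p (Fin.last m) x)
        (p' := Function.update p' (Fin.last m) x) (by simp)
      simp only [Function.update_of_ne (Fin.castSucc_ne_last _)] at hx
      linarith
    have hgrad : gradient (fun x => H (q, Function.update p (Fin.last m) x)) (p (Fin.last m)) =
        gradient (fun x => H (q, Function.update p' (Fin.last m) x)) (p' (Fin.last m)) := by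
      rw [hfun, h, gradient, gradient, fderiv_add_const]
    have hp : G (q, p) = (∑ j : Fin m, ⟪p j.castSucc, q j.succ⟫) + ⟪p (Fin.last m),
        gradient (fun x => H (q, Function.update p (Fin.last m) x)) (p (Fin.last m))⟫ -
          H (q, p) := hG q p
    have hp' : G (q, p') = (∑ j : Fin m, ⟪p' j.castSucc, q j.succ⟫) + ⟪p' (Fin.last m),
        gradient (fun x => H (q, Function.update p' (Fin.last m) x)) (p' (Fin.last m))⟫ -
          H (q, p') := hG q p'
    rw [hp, hp', hgrad, h]
    linarith [haffine q h]
  refine ⟨fun q p s hs v => fderiv_apply_eq_zero_of_forall_add_smul_eq fun t => ?_, hproj⟩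
  rw [Prod.smul_mk, Prod.mk_add_mk, smul_zero, add_zero]
  refine hproj q _ p ?_
  have hne : Fin.last m ≠ ⟨s, by omega⟩ := by
    simp only [ne_eq, Fin.ext_iff, Fin.val_last]
    omega
  simp [Pi.single_eq_of_ne hne]
end

section
/- (Hamilton's equations for the javelin system imply the Euler–Lagrange equations.) Let q₀, q₁, p⁰, p¹ : ℝ → ℝ³ be differentiable functions satisfying, for all t ∈ ℝ, Hamilton's equations (p⁰)'(t) = 0, (p¹)'(t) = −p⁰(t) + q₁(t), (q₀)'(t) = q₁(t), (q₁)'(t) = −p¹(t). Then q₀ is four times differentiable and q₀''''(t) + q₀''(t) = 0 for all t ∈ ℝ. -/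
/-- Hamilton's equations for the javelin system imply the Euler–Lagrange
equations: if `(q₀, q₁, p⁰, p¹)` satisfy `(p⁰)' = 0`, `(p¹)' = −p⁰ + q₁`,
`(q₀)' = q₁` and `(q₁)' = −p¹`, then `q₀` is four times differentiable and
`q₀'''' + q₀'' = 0`. -/
theorem javelin_hamilton_implies_euler_lagrange
    (q₀ q₁ p₀ p₁ : ℝ → EuclideanSpace ℝ (Fin 3))
    (hq₀ : Differentiable ℝ q₀) (hq₁ : Differentiable ℝ q₁)
    (hp₀ : Differentiable ℝ p₀) (hp₁ : Differentiable ℝ p₁)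
    (e₁ : ∀ t, deriv p₀ t = 0)
    (e₂ : ∀ t, deriv p₁ t = -p₀ t + q₁ t)
    (e₃ : ∀ t, deriv q₀ t = q₁ t)
    (e₄ : ∀ t, deriv q₁ t = -p₁ t) :
    (∀ i ≤ 3, Differentiable ℝ (iteratedDeriv i q₀)) ∧
    ∀ t, iteratedDeriv 4 q₀ t + iteratedDeriv 2 q₀ t = 0 := by
  have d₁ : iteratedDeriv 1 q₀ = q₁ := by
    rw [iteratedDeriv_one]; exact funext e₃
  have d₂ : iteratedDeriv 2 q₀ = -p₁ := by
    rw [iteratedDeriv_succ, d₁]; exact funext e₄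
  have d₃ : iteratedDeriv 3 q₀ = p₀ - q₁ := by
    rw [iteratedDeriv_succ, d₂]
    funext t
    rw [deriv.neg, e₂, Pi.sub_apply]
    abel
  have d₄ : iteratedDeriv 4 q₀ = p₁ := by
    rw [iteratedDeriv_succ, d₃]
    funext t
    rw [deriv_sub (hp₀ t) (hq₁ t), e₁, e₄]
    simp
  refine ⟨fun i hi => ?_, fun t => by simp [d₄, d₂]⟩
  interval_cases i
  · rwa [iteratedDeriv_zero]
  · rwa [d₁]
  · rw [d₂]; exact hp₁.neg
  · rw [d₃]; exact hp₀.sub hq₁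
end
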